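/- arXiv:1009.1523 — 3 statements merged into one kernel-verified Lean document; each statement's English description precedes it below -/
import Mathlib

section
/- If 𝔦₁ and 𝔦₂ are megaideals of a Lie algebra 𝔤 over a field k, then their Lie product [𝔦₁, 𝔦₂], i.e., the linear span of all brackets ⁅a, b⁆ with a ∈ 𝔦₁ and b ∈ 𝔦₂, is again a megaideal of 𝔤. -/
/-- A megaideal of a Lie algebra `L` over a field `k` is a vector subspace invariant under
(the linear map underlying) every Lie algebra automorphism of `L`. -/
def IsMegaideal (k : Type*) {L : Type*} [Field k] [LieRing L] [LieAlgebra k L]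
    (I : Submodule k L) : Prop :=
  ∀ e : L ≃ₗ⁅k⁆ L, I.map e.toLinearEquiv.toLinearMap = I

/-- The Lie product of two megaideals, i.e. the linear span of all brackets `⁅a, b⁆` with
`a ∈ I₁` and `b ∈ I₂`, is a megaideal. -/
theorem isMegaideal_lieProduct {k L : Type*} [Field k] [LieRing L] [LieAlgebra k L]
    {I₁ I₂ : Submodule k L} (h₁ : IsMegaideal k I₁) (h₂ : IsMegaideal k I₂) :
    IsMegaideal k (Submodule.span k {x : L | ∃ a ∈ I₁, ∃ b ∈ I₂, x = ⁅a, b⁆}) := by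
  intro e
  rw [Submodule.map_span]
  congr 1
  ext y
  constructor
  · rintro ⟨_, ⟨a, ha, b, hb, rfl⟩, rfl⟩
    exact ⟨e a, h₁ e ▸ Submodule.mem_map_of_mem ha, e b, h₂ e ▸ Submodule.mem_map_of_mem hb,
      e.map_lie a b⟩
  · rintro ⟨a, ha, b, hb, rfl⟩
    rw [← h₁ e] at ha
    rw [← h₂ e] at hb
    obtain ⟨a, ha, rfl⟩ := ha
    obtain ⟨b, hb, rfl⟩ := hb
    exact ⟨⁅a, b⁆, ⟨a, ha, b, hb, rfl⟩, e.map_lie a b⟩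
end

section
/- Any megaideal of a finite-dimensional real Lie algebra is a Lie ideal: if 𝔤 is a finite-dimensional Lie algebra over ℝ and 𝔦 is a vector subspace of 𝔤 such that e(𝔦) = 𝔦 for every Lie algebra automorphism e of 𝔤, then ⁅x, a⁆ ∈ 𝔦 for every x ∈ 𝔤 and a ∈ 𝔦. -/
open NormedSpace in
/-- In a real Banach algebra, `exp (-x)` is a right inverse of `exp x`. -/
theorem NormedSpace.exp_mul_exp_neg_real {𝔸 : Type*} [NormedRing 𝔸] [NormedAlgebra ℝ 𝔸]
    [CompleteSpace 𝔸] (x : 𝔸) : exp x * exp (-x) = 1 := by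
  let : NormedAlgebra ℚ 𝔸 := NormedAlgebra.restrictScalars ℚ ℝ 𝔸
  rw [← exp_add_of_commute (Commute.refl x).neg_right, add_neg_cancel, exp_zero]

open NormedSpace in
/-- The exponential of a derivation of a continuous bilinear product preserves the product. -/
theorem ContinuousLinearMap.exp_apply_bilin_of_derivation {V : Type*} [NormedAddCommGroup V]
    [NormedSpace ℝ V] [CompleteSpace V] (B : V →L[ℝ] V →L[ℝ] V) (D : V →L[ℝ] V)
    (hD : ∀ a b, D (B a b) = B (D a) b + B a (D b)) (a b : V) :
    exp D (B a b) = B (exp D a) (exp D b) := by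
  have hexp (A : V →L[ℝ] V) (v : V) (t : ℝ) :
      HasDerivAt (fun s : ℝ ↦ exp (s • A) v) (A (exp (t • A) v)) t := by
    simpa using (hasDerivAt_exp_smul_const' A t).clm_apply (hasDerivAt_const t v)
  have hF (t : ℝ) : HasDerivAt
      (fun s : ℝ ↦ exp (s • -D) (B (exp (s • D) a) (exp (s • D) b))) 0 t := by
    have h1 := (B.hasFDerivAt.comp_hasDerivAt t (hexp D a t)).clm_apply (hexp D b t)
    have h2 := (hasDerivAt_exp_smul_const (-D) t).clm_apply h1
    refine h2.congr_deriv ?_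
    simp [hD]
  have hconst := is_const_of_deriv_eq_zero (fun t ↦ (hF t).differentiableAt)
    (fun t ↦ (hF t).deriv) 1 0
  simp only [one_smul, zero_smul, exp_zero, one_apply_eq_self] at hconst
  rw [← hconst, ← mul_apply_eq_comp, exp_mul_exp_neg_real, one_apply_eq_self]

open NormedSpace in
/-- A derivation of a finite-dimensional real Lie algebra is the velocity at `0` of a family of
automorphisms. Differentiability is tested against linear functionals, so that no norm on the
Lie algebra has to be chosen. -/
theorem LieAlgebra.exists_equiv_hasDerivAt_derivation {L : Type*} [LieRing L] [LieAlgebra ℝ L]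
    [FiniteDimensional ℝ L] (D : LieDerivation ℝ L L) :
    ∃ e : ℝ → L ≃ₗ⁅ℝ⁆ L, ∀ (f : L →ₗ[ℝ] ℝ) (a : L),
      HasDerivAt (fun t ↦ f (e t a)) (f (D a)) 0 := by
  let φ : L ≃ₗ[ℝ] (Fin (Module.finrank ℝ L) → ℝ) := (Module.finBasis ℝ L).equivFun
  let A : (Fin (Module.finrank ℝ L) → ℝ) →L[ℝ] (Fin (Module.finrank ℝ L) → ℝ) :=
    LinearMap.toContinuousLinearMap (φ.conj (D : L →ₗ[ℝ] L))
  let B : (Fin (Module.finrank ℝ L) → ℝ) →L[ℝ] (Fin (Module.finrank ℝ L) → ℝ) →L[ℝ]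
      (Fin (Module.finrank ℝ L) → ℝ) :=
    LinearMap.toContinuousLinearMap (LinearMap.toContinuousLinearMap.toLinearMap ∘ₗ
      φ.conj.toLinearMap ∘ₗ (LieModule.toEnd ℝ L L : L →ₗ[ℝ] Module.End ℝ L) ∘ₗ
        φ.symm.toLinearMap)
  have hA (v) : A v = φ (D (φ.symm v)) := rfl
  have hB (v w) : B v w = φ ⁅φ.symm v, φ.symm w⁆ := rfl
  have hlie (t : ℝ) (v w) : exp (t • A) (B v w) = B (exp (t • A) v) (exp (t • A) w) := by
    refine ContinuousLinearMap.exp_apply_bilin_of_derivation B (t • A) (fun v w ↦ ?_) v w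
    simp only [smul_apply, hA, hB, map_smul, LinearEquiv.symm_apply_apply,
      LieDerivation.apply_lie_eq_add, lie_smul, map_add, smul_add]
    abel
  have hinv (X : (Fin (Module.finrank ℝ L) → ℝ) →L[ℝ] (Fin (Module.finrank ℝ L) → ℝ)) :
      exp X * exp (-X) = 1 := exp_mul_exp_neg_real X
  refine ⟨fun t ↦
    { toLinearMap := φ.symm.conj (exp (t • A)).toLinearMap
      invFun := φ.symm.conj (exp (-(t • A))).toLinearMap
      map_lie' := fun {x y} ↦ ?_
      left_inv := fun x ↦ ?_
      right_inv := fun x ↦ ?_ }, fun f a ↦ ?_⟩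
  · have h := hlie t (φ x) (φ y)
    simp only [hB, LinearEquiv.symm_apply_apply] at h
    simp [LinearEquiv.conj_apply, h]
  · have h := DFunLike.congr_fun (hinv (-(t • A))) (φ x)
    simp only [neg_neg, mul_apply_eq_comp, one_apply_eq_self] at h
    simp [LinearEquiv.conj_apply, h]
  · have h := DFunLike.congr_fun (hinv (t • A)) (φ x)
    simp only [mul_apply_eq_comp, one_apply_eq_self] at h
    simp [LinearEquiv.conj_apply, h]
  · have h := (f ∘ₗ φ.symm.toLinearMap).toContinuousLinearMap.hasFDerivAt.comp_hasDerivAt 0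
      ((hasDerivAt_exp_smul_const A (0 : ℝ)).clm_apply (hasDerivAt_const 0 (φ a)))
    refine h.congr_deriv ?_
    simp [hA]

/-- Any megaideal of a finite-dimensional real Lie algebra is a Lie ideal: if a subspace `I` is
invariant under (the linear map underlying) every Lie algebra automorphism, then it is closed
under taking brackets with arbitrary elements of the algebra. -/
theorem lie_mem_of_isMegaideal {L : Type*} [LieRing L] [LieAlgebra ℝ L]
    [FiniteDimensional ℝ L] (I : Submodule ℝ L)
    (hI : ∀ e : L ≃ₗ⁅ℝ⁆ L, I.map e.toLinearEquiv.toLinearMap = I) :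
    ∀ x : L, ∀ a ∈ I, ⁅x, a⁆ ∈ I := by
  intro x a ha
  by_contra hxa
  obtain ⟨f, hf, hIf⟩ := Submodule.exists_le_ker_of_notMem hxa
  obtain ⟨e, he⟩ := LieAlgebra.exists_equiv_hasDerivAt_derivation (LieDerivation.ad ℝ L x)
  have hzero (t : ℝ) : f (e t a) = 0 := by
    refine hIf ?_
    rw [← hI (e t)]
    exact Submodule.mem_map_of_mem ha
  have h := he f a
  simp only [hzero] at h
  exact hf (by simpa using h.unique (hasDerivAt_const 0 0))
end

section
/- Commutation relations with the scaling generator of the symmetry algebra of the barotropic vorticity equation: let D, 𝒳(f), 𝒵(g), ∂_t, ∂_y be the first-order differential operators defined in the context, acting on smooth functions F : ℝ⁴ → ℝ. Then for every smooth F : ℝ⁴ → ℝ and all smooth f, g : ℝ → ℝ: (i) ∂_t(D F) − D(∂_t F) = ∂_t F; (ii) ∂_y(D F) − D(∂_y F) = −∂_y F; (iii) D(𝒳(f) F) − 𝒳(f)(D F) = 𝒳(h) F, where h(t) = t·f′(t) + f(t); (iv) D(𝒵(g) F) − 𝒵(g)(D F) = 𝒵(k) F, where k(t) = t·g′(t)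 + 3·g(t). -/
noncomputable section

/-- Partial derivative of `F : ℝ⁴ → ℝ` with respect to the `i`-th coordinate. -/
def pd (i : Fin 4) (F : (Fin 4 → ℝ) → ℝ) (p : Fin 4 → ℝ) : ℝ :=
  fderiv ℝ F p (Pi.single i 1)

/-- The scaling generator `𝒟 = t∂_t − x∂_x − y∂_y − 3ψ∂_ψ` acting on functions of
`(t, x, y, ψ)`. -/
def Dop (F : (Fin 4 → ℝ) → ℝ) (p : Fin 4 → ℝ) : ℝ :=
  p 0 * pd 0 F p - p 1 * pd 1 F p - p 2 * pd 2 F p - 3 * p 3 * pd 3 F p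

/-- The generator `𝒳(f) = f(t)∂_x − f′(t)y∂_ψ` acting on functions of `(t, x, y, ψ)`. -/
def Xop (f : ℝ → ℝ) (F : (Fin 4 → ℝ) → ℝ) (p : Fin 4 → ℝ) : ℝ :=
  f (p 0) * pd 1 F p - deriv f (p 0) * p 2 * pd 3 F p

/-- The generator `𝒵(g) = g(t)∂_ψ` acting on functions of `(t, x, y, ψ)`. -/
def Zop (g : ℝ → ℝ) (F : (Fin 4 → ℝ) → ℝ) (p : Fin 4 → ℝ) : ℝ :=
  g (p 0) * pd 3 F p

theorem ContDiff.pd {F : (Fin 4 → ℝ) → ℝ} (hF : ContDiff ℝ (⊤ : ℕ∞) F) (i : Fin 4) :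
    ContDiff ℝ (⊤ : ℕ∞) (pd i F) :=
  (hF.fderiv_right (m := (⊤ : ℕ∞)) (by simp)).clm_apply contDiff_const

theorem ContDiff.differentiable_pd {F : (Fin 4 → ℝ) → ℝ} (hF : ContDiff ℝ (⊤ : ℕ∞) F)
    (i : Fin 4) : Differentiable ℝ (_root_.pd i F) :=
  (hF.pd i).differentiable (by simp)

theorem pd_comm {F : (Fin 4 → ℝ) → ℝ} (hF : ContDiff ℝ (⊤ : ℕ∞) F) (i j : Fin 4)
    (p : Fin 4 → ℝ) : pd i (pd j F) p = pd j (pd i F) p := by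
  have hd : DifferentiableAt ℝ (fderiv ℝ F) p :=
    (hF.fderiv_right (m := (⊤ : ℕ∞)) (by simp)).differentiable (by simp) p
  have key (a b : Fin 4) :
      pd a (pd b F) p = fderiv ℝ (fderiv ℝ F) p (Pi.single a 1) (Pi.single b 1) := by
    change fderiv ℝ (fun q => fderiv ℝ F q (Pi.single b 1)) p (Pi.single a 1) = _
    rw [fderiv_clm_apply hd (differentiableAt_const _)]
    simp
  have hs : IsSymmSndFDerivAt ℝ F p := hF.contDiffAt.isSymmSndFDerivAt (by
    rw [minSmoothness_of_isRCLikeNormedField]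
    exact WithTop.coe_le_coe.mpr (le_top (a := (2 : ℕ∞))))
  rw [key, key, hs.eq]

theorem pd_sub {F G : (Fin 4 → ℝ) → ℝ} (hF : Differentiable ℝ F) (hG : Differentiable ℝ G)
    (i : Fin 4) (p : Fin 4 → ℝ) : pd i (fun q => F q - G q) p = pd i F p - pd i G p := by
  simp [pd, fderiv_fun_sub (hF p) (hG p)]

theorem pd_mul {F G : (Fin 4 → ℝ) → ℝ} (hF : Differentiable ℝ F) (hG : Differentiable ℝ G)
    (i : Fin 4) (p : Fin 4 → ℝ) :
    pd i (fun q => F q * G q) p = F p * pd i G p + G p * pd i F p := by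
  simp [pd, fderiv_fun_mul (hF p) (hG p)]

theorem pd_comp_coord {f : ℝ → ℝ} (hf : Differentiable ℝ f) (i j : Fin 4) (p : Fin 4 → ℝ) :
    pd i (fun q => f (q j)) p = if i = j then deriv f (p j) else 0 := by
  have h : HasFDerivAt (fun q : Fin 4 → ℝ => f (q j))
      (deriv f (p j) • ContinuousLinearMap.proj (R := ℝ) (φ := fun _ : Fin 4 => ℝ) j) p :=
    (hf (p j)).hasDerivAt.comp_hasFDerivAt p (hasFDerivAt_apply j p)
  rw [pd, h.fderiv]
  simp [Pi.single_apply, eq_comm]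

theorem pd_coord (i j : Fin 4) (p : Fin 4 → ℝ) :
    pd i (fun q => q j) p = if i = j then 1 else 0 := by
  simpa using pd_comp_coord differentiable_id i j p

theorem pd_const_mul_coord (c : ℝ) (i j : Fin 4) (p : Fin 4 → ℝ) :
    pd i (fun q => c * q j) p = if i = j then c else 0 := by
  simpa [deriv_const_mul_field] using
    pd_comp_coord (f := fun t => c * t) (by fun_prop) i j p

theorem pd_Dop {F : (Fin 4 → ℝ) → ℝ} (hF : ContDiff ℝ (⊤ : ℕ∞) F) (i : Fin 4)
    (p : Fin 4 → ℝ) :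
    pd i (Dop F) p = Dop (pd i F) p + (if i = 0 then pd 0 F p else 0)
      - (if i = 1 then pd 1 F p else 0) - (if i = 2 then pd 2 F p else 0)
      - (if i = 3 then 3 * pd 3 F p else 0) := by
  have h := hF.differentiable_pd
  have h0 := h 0
  have h1 := h 1
  have h2 := h 2
  have h3 := h 3
  unfold Dop
  rw [pd_sub (by fun_prop) (by fun_prop), pd_sub (by fun_prop) (by fun_prop),
    pd_sub (by fun_prop) (by fun_prop), pd_mul (by fun_prop) h0, pd_mul (by fun_prop) h1,
    pd_mul (by fun_prop) h2, pd_mul (by fun_prop) h3, pd_coord, pd_coord, pd_coord,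
    pd_const_mul_coord, pd_comm hF i 0, pd_comm hF i 1, pd_comm hF i 2, pd_comm hF i 3]
  fin_cases i <;> simp <;> ring

theorem Dop_sub {F G : (Fin 4 → ℝ) → ℝ} (hF : Differentiable ℝ F) (hG : Differentiable ℝ G)
    (p : Fin 4 → ℝ) : Dop (fun q => F q - G q) p = Dop F p - Dop G p := by
  simp only [Dop, pd_sub hF hG]
  ring

theorem Dop_mul {F G : (Fin 4 → ℝ) → ℝ} (hF : Differentiable ℝ F) (hG : Differentiable ℝ G)
    (p : Fin 4 → ℝ) : Dop (fun q => F q * G q) p = F p * Dop G p + G p * Dop F p := by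
  simp only [Dop, pd_mul hF hG]
  ring

theorem Dop_comp_time {f : ℝ → ℝ} (hf : Differentiable ℝ f) (p : Fin 4 → ℝ) :
    Dop (fun q => f (q 0)) p = p 0 * deriv f (p 0) := by
  simp [Dop, pd_comp_coord hf]

theorem Dop_coord_two (p : Fin 4 → ℝ) : Dop (fun q => q 2) p = -p 2 := by
  simp [Dop, pd_coord]

theorem deriv_id_mul_deriv_add {f : ℝ → ℝ} (hf : Differentiable ℝ f)
    (hf' : Differentiable ℝ (deriv f)) (t : ℝ) :
    deriv (fun t => t * deriv f t + f t) t = t * deriv (deriv f) t + 2 * deriv f t := by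
  have h := ((hasDerivAt_id t).mul (hf' t).hasDerivAt).add (hf t).hasDerivAt
  refine h.deriv.trans ?_
  simp only [id]
  ring

/-- Commutation relations with the scaling generator `𝒟` of the maximal Lie invariance algebra of
the barotropic vorticity equation: `[∂_t, 𝒟] = ∂_t`, `[∂_y, 𝒟] = −∂_y`,
`[𝒟, 𝒳(f)] = 𝒳(tf′ + f)` and `[𝒟, 𝒵(g)] = 𝒵(tg′ + 3g)`. -/
theorem vorticity_commutation_relations_with_scaling
    (F : (Fin 4 → ℝ) → ℝ) (hF : ContDiff ℝ (⊤ : ℕ∞) F)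
    (f g : ℝ → ℝ) (hf : ContDiff ℝ (⊤ : ℕ∞) f) (hg : ContDiff ℝ (⊤ : ℕ∞) g) :
    (∀ p, pd 0 (Dop F) p - Dop (pd 0 F) p = pd 0 F p) ∧
    (∀ p, pd 2 (Dop F) p - Dop (pd 2 F) p = -pd 2 F p) ∧
    (∀ p, Dop (Xop f F) p - Xop f (Dop F) p
      = Xop (fun t => t * deriv f t + f t) F p) ∧
    (∀ p, Dop (Zop g F) p - Zop g (Dop F) p
      = Zop (fun t => t * deriv g t + 3 * g t) F p) := by
  have h1 := hF.differentiable_pd 1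
  have h3 := hF.differentiable_pd 3
  have hfd : Differentiable ℝ f := hf.differentiable (by simp)
  have hgd : Differentiable ℝ g := hg.differentiable (by simp)
  have hfd' : Differentiable ℝ (deriv f) :=
    (contDiff_infty_iff_deriv.mp hf).2.differentiable (by simp)
  refine ⟨fun p => ?_, fun p => ?_, fun p => ?_, fun p => ?_⟩
  · simp [pd_Dop hF]
  · simp [pd_Dop hF]
  · have hX : Dop (Xop f F) p = _ := Dop_sub (F := fun q => f (q 0) * pd 1 F q)
      (G := fun q => deriv f (q 0) * q 2 * pd 3 F q) (by fun_prop) (by fun_prop) p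
    rw [hX, Dop_mul (by fun_prop) h1, Dop_mul (by fun_prop) h3,
      Dop_mul (by fun_prop) (by fun_prop), Dop_comp_time hfd, Dop_comp_time hfd', Dop_coord_two]
    simp only [Xop, pd_Dop hF, deriv_id_mul_deriv_add hfd hfd']
    simp
    ring
  · have hZ : Dop (Zop g F) p = _ :=
      Dop_mul (F := fun q => g (q 0)) (G := pd 3 F) (by fun_prop) h3 p
    rw [hZ, Dop_comp_time hgd]
    simp only [Zop, pd_Dop hF]
    simp
    ring

end
end
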